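/- Let (X,Φ) be a regular topological flow, let S be a global closed cross-section of time η > 0 with φ_{[−ξ,ξ]}(S) = X for some ξ > 0, and let x ∈ S be a point at which the first return time t_S : S → ℝ is not continuous. Then there exists t ∈ [0,2ξ] such that φ_t(x) ∈ ∂^Φ S. -/

import Mathlib

open Set Filter Topology MeasureTheory

namespace FlowPaper

variable {X : Type*} [MetricSpace X]

/-- The flow `Φ` is regular when no point is fixed by the whole flow. -/
def Regular (Φ : Flow ℝ X) : Prop := ∀ x : X, ∃ t : ℝ, Φ t x ≠ x

/-- `φ_I(E) = {φ_t x : t ∈ I, x ∈ E}`. -/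
def flowSet (Φ : Flow ℝ X) (I : Set ℝ) (E : Set X) : Set X := ⋃ t ∈ I, Φ t '' E

/-- The `ζ`-cylinder `S_ζ = φ_{[-ζ,ζ]}(S)`. -/
def cyl (Φ : Flow ℝ X) (S : Set X) (ζ : ℝ) : Set X := flowSet Φ (Icc (-ζ) ζ) S

/-- `S` is a cross-section of time `η` if `Φ` is injective on `S × [-η,η]`. -/
def IsCrossSection (Φ : Flow ℝ X) (S : Set X) (η : ℝ) : Prop :=
  Set.InjOn (fun p : X × ℝ => Φ p.2 p.1) (S ×ˢ Icc (-η) η)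

/-- Weakly extendable cross-section of time `η`. -/
def IsWec (Φ : Flow ℝ X) (S : Set X) (η : ℝ) : Prop :=
  IsCrossSection Φ S η ∧ IsCrossSection Φ (closure S) η

/-- The flow interior `Int^Φ(S) = Int(S_η) ∩ S`. -/
def flowInterior (Φ : Flow ℝ X) (S : Set X) (η : ℝ) : Set X := interior (cyl Φ S η) ∩ S

/-- The flow boundary `∂^Φ S = closure S \ Int^Φ(S)`. -/
def flowBoundary (Φ : Flow ℝ X) (S : Set X) (η : ℝ) : Set X := closure S \ flowInterior Φ S η

/-- `∂^Φ S_ζ = φ_{[-ζ,ζ]}(∂^Φ S)`. -/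
def flowBoundaryCyl (Φ : Flow ℝ X) (S : Set X) (η ζ : ℝ) : Set X := cyl Φ (flowBoundary Φ S η) ζ

/-- A cross-section is global when some cylinder covers `X`. -/
def IsGlobal (Φ : Flow ℝ X) (S : Set X) : Prop := ∃ ξ > 0, cyl Φ S ξ = univ

/-- First return time `t_S(x) = inf {t > 0 : φ_t x ∈ S}`. -/
noncomputable def returnTime (Φ : Flow ℝ X) (S : Set X) (x : X) : ℝ :=
  sInf {t : ℝ | 0 < t ∧ Φ t x ∈ S}

/-- First return map `T_S(x) = φ_{t_S(x)}(x)`. -/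
noncomputable def returnMap (Φ : Flow ℝ X) (S : Set X) (x : X) : X := Φ (returnTime Φ S x) x

/-- A measure is `Φ`-invariant when it is invariant under every time `t`-map. -/
def FlowInvariant [MeasurableSpace X] (Φ : Flow ℝ X) (μ : Measure X) : Prop :=
  ∀ t : ℝ, Measure.map (Φ t) μ = μ

/-- A w.e.c. `S` of time `η` has small flow boundary when `∂^Φ S_η` is a null set. -/
def HasSmallFlowBoundary [MeasurableSpace X] (Φ : Flow ℝ X) (S : Set X) (η : ℝ) : Prop :=
  ∀ μ : Measure X, IsProbabilityMeasure μ → FlowInvariant Φ μ → μ (flowBoundaryCyl Φ S η η) = 0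

/-- The small flow boundary property of a flow. -/
def SmallFlowBoundaryProperty [MeasurableSpace X] (Φ : Flow ℝ X) : Prop :=
  ∀ x : X, ∀ S' : Set X, ∀ η : ℝ, 0 < η → IsWec Φ S' η → x ∈ flowInterior Φ S' η →
    ∃ S ⊆ S', x ∈ flowInterior Φ S η ∧ IsWec Φ S η ∧ HasSmallFlowBoundary Φ S η

/-- The frontier of `A` with respect to the topology induced on `B`. -/
def frontierIn (B A : Set X) : Set X :=
  Subtype.val '' (frontier (Subtype.val ⁻¹' A : Set B))

/-- A positive time at which a point of a cross-section returns to it exceeds the time of the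
cross-section. -/
lemma IsCrossSection.lt_of_mem {X : Type*} [MetricSpace X] {Φ : Flow ℝ X} {S : Set X} {η : ℝ}
    (hS : IsCrossSection Φ S η) {x : X} (hx : x ∈ S) {t : ℝ} (ht : 0 < t) (h : Φ t x ∈ S) :
    η < t := by
  by_contra! hle
  have h0 := @hS (x, t) ⟨hx, by constructor <;> linarith⟩ (Φ t x, 0)
    ⟨h, by constructor <;> linarith⟩ (by simp)
  exact ht.ne' (congrArg Prod.snd h0)

lemma returnTime_le {X : Type*} [MetricSpace X] {Φ : Flow ℝ X} {S : Set X} {x : X} {t : ℝ}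
    (ht : 0 < t) (h : Φ t x ∈ S) : returnTime Φ S x ≤ t :=
  csInf_le ⟨0, fun _ hs => hs.1.le⟩ ⟨ht, h⟩

lemma mem_cyl {X : Type*} [MetricSpace X] {Φ : Flow ℝ X} {S : Set X} {x : X} {ζ : ℝ} :
    x ∈ cyl Φ S ζ ↔ ∃ u ∈ Icc (-ζ) ζ, Φ (-u) x ∈ S := by
  simp only [cyl, flowSet, mem_iUnion, mem_image, exists_prop]
  refine exists_congr fun u => and_congr_right fun _ => ⟨?_, fun h => ⟨_, h, ?_⟩⟩
  · rintro ⟨z, hz, rfl⟩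
    simpa [← Φ.map_add] using hz
  · simp [← Φ.map_add]

lemma exists_return_of_cyl_eq_univ {X : Type*} [MetricSpace X] {Φ : Flow ℝ X} {S : Set X}
    {ξ : ℝ} (hglob : cyl Φ S ξ = univ) (x : X) {ε : ℝ} (hε : 0 < ε) :
    ∃ t, 0 < t ∧ t ≤ 2 * ξ + ε ∧ Φ t x ∈ S := by
  obtain ⟨u, hu, h⟩ := mem_cyl.1 (hglob ▸ mem_univ (Φ (ξ + ε) x))
  rw [← Φ.map_add] at h
  exact ⟨_, by linarith [hu.2], by linarith [hu.1], h⟩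

lemma returnTime_le_two_mul {X : Type*} [MetricSpace X] {Φ : Flow ℝ X} {S : Set X}
    {ξ : ℝ} (hglob : cyl Φ S ξ = univ) (x : X) : returnTime Φ S x ≤ 2 * ξ := by
  refine le_of_forall_pos_le_add fun ε hε => ?_
  obtain ⟨t, h0, hle, ht⟩ := exists_return_of_cyl_eq_univ hglob x hε
  exact (returnTime_le h0 ht).trans hle

lemma IsCrossSection.le_returnTime {X : Type*} [MetricSpace X] {Φ : Flow ℝ X} {S : Set X}
    {η ξ : ℝ} (hS : IsCrossSection Φ S η) (hglob : cyl Φ S ξ = univ) {x : X} (hx : x ∈ S) :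
    η ≤ returnTime Φ S x := by
  obtain ⟨t, h0, -, ht⟩ := exists_return_of_cyl_eq_univ hglob x one_pos
  exact le_csInf ⟨t, h0, ht⟩ fun s hs => (hS.lt_of_mem hx hs.1 hs.2).le

lemma IsCrossSection.returnTime_mem {X : Type*} [MetricSpace X] {Φ : Flow ℝ X} {S : Set X}
    {η ξ : ℝ} (hS : IsCrossSection Φ S η) (hη : 0 < η) (hcl : IsClosed S)
    (hglob : cyl Φ S ξ = univ) {x : X} (hx : x ∈ S) : Φ (returnTime Φ S x) x ∈ S := by
  obtain ⟨t, h0, -, ht⟩ := exists_return_of_cyl_eq_univ hglob x one_pos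
  have hset : {t : ℝ | 0 < t ∧ Φ t x ∈ S} = Ici η ∩ (fun t => Φ t x) ⁻¹' S := by
    ext s
    exact ⟨fun hs => ⟨(hS.lt_of_mem hx hs.1 hs.2).le, hs.2⟩, fun hs => ⟨hη.trans_le hs.1, hs.2⟩⟩
  have hclosed : IsClosed {t : ℝ | 0 < t ∧ Φ t x ∈ S} := by
    rw [hset]
    exact isClosed_Ici.inter (hcl.preimage (Φ.continuous continuous_id continuous_const))
  exact (hclosed.csInf_mem ⟨t, h0, ht⟩ ⟨0, fun _ hs => hs.1.le⟩).2

/-- The first return time is continuous at every point whose first return lies in the flow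
interior. -/
lemma IsCrossSection.continuousWithinAt_returnTime {X : Type*} [MetricSpace X] {Φ : Flow ℝ X}
    {S : Set X} {η ξ : ℝ} (hS : IsCrossSection Φ S η) (hη : 0 < η) (hcl : IsClosed S)
    (hglob : cyl Φ S ξ = univ) {x : X} (hx : x ∈ S)
    (hint : returnMap Φ S x ∈ flowInterior Φ S η) :
    ContinuousWithinAt (returnTime Φ S) S x := by
  set T := returnTime Φ S x
  have hTpos : 0 < T := hη.trans_le (hS.le_returnTime hglob hx)
  refine tendsto_iff_ultrafilter _ _ _ |>.2 fun g hg => ?_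
  have hgx : Tendsto id (g : Filter X) (𝓝 x) := hg.trans nhdsWithin_le_nhds
  have hgS : ∀ᶠ w in (g : Filter X), w ∈ S := hg self_mem_nhdsWithin
  have hflow {f : X → ℝ} {a : ℝ} (hf : Tendsto f g (𝓝 a)) :
      Tendsto (fun w => Φ (f w) w) g (𝓝 (Φ a x)) :=
    ((Φ.continuous continuous_fst continuous_snd).tendsto (a, x)).comp (hf.prodMk_nhds hgx)
  obtain ⟨c, hc, hgc⟩ := isCompact_Icc.ultrafilter_le_nhds (g.map (returnTime Φ S))
    (le_principal_iff.2 <| show ∀ᶠ w in (g : Filter X), returnTime Φ S w ∈ Icc η (2 * ξ) from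
      hgS.mono fun w hw => ⟨hS.le_returnTime hglob hw, returnTime_le_two_mul hglob w⟩)
  have hgc : Tendsto (returnTime Φ S) g (𝓝 c) := hgc
  have hTc : T ≤ c := returnTime_le (hη.trans_le hc.1) <|
    hcl.mem_of_tendsto (hflow hgc) (hgS.mono fun w hw => hS.returnTime_mem hη hcl hglob hw)
  have hcyl : ∀ᶠ w in (g : Filter X), Φ T w ∈ cyl Φ S η :=
    (hflow tendsto_const_nhds).eventually (mem_interior_iff_mem_nhds.1 hint.1)
  have hcyl' : ∀ᶠ w in (g : Filter X), ∃ u ∈ Icc (-η) η, Φ (T - u) w ∈ S := by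
    filter_upwards [hcyl] with w hw
    obtain ⟨u, hu, h⟩ := mem_cyl.1 hw
    rw [← Φ.map_add] at h
    exact ⟨u, hu, by rwa [sub_eq_neg_add]⟩
  obtain ⟨u, hu⟩ := hcyl'.choice
  obtain ⟨a, ha, hga⟩ := isCompact_Icc.ultrafilter_le_nhds (g.map u)
    (le_principal_iff.2 <| show ∀ᶠ w in (g : Filter X), u w ∈ Icc (-η) η from
      hu.mono fun w hw => hw.1)
  have hga : Tendsto u g (𝓝 a) := hga
  have hTu : Tendsto (fun w => T - u w) g (𝓝 (T - a)) := tendsto_const_nhds.sub hga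
  have haS : Φ (T - a) x ∈ S := hcl.mem_of_tendsto (hflow hTu) (hu.mono fun w hw => hw.2)
  have ha0 : a = 0 := congrArg Prod.snd <| @hS (Φ (T - a) x, a) ⟨haS, ha⟩ (Φ T x, 0)
    ⟨hint.2, by constructor <;> linarith⟩ (by simp [← Φ.map_add])
  rw [ha0, sub_zero] at hTu
  have hcT : c ≤ T := le_of_tendsto_of_tendsto hgc hTu <| by
    filter_upwards [hu, hTu.eventually (lt_mem_nhds hTpos)] with w hw hpos
    exact returnTime_le hpos hw.2
  rwa [hcT.antisymm hTc] at hgc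

/-- a discontinuity point of the first return time of a global closed
cross-section hits the flow boundary within time `2ξ`. -/
theorem returnTime_discontinuity_hits_flowBoundary {X : Type*} [MetricSpace X] [CompactSpace X]
    (Φ : Flow ℝ X) (hreg : Regular Φ) (S : Set X) (η ξ : ℝ) (hη : 0 < η) (hξ : 0 < ξ)
    (hcl : IsClosed S) (hS : IsCrossSection Φ S η) (hglob : cyl Φ S ξ = univ)
    (x : X) (hx : x ∈ S) (hdisc : ¬ ContinuousWithinAt (returnTime Φ S) S x) :
    ∃ t ∈ Icc (0 : ℝ) (2 * ξ), Φ t x ∈ flowBoundary Φ S η := by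
  refine ⟨returnTime Φ S x, ⟨hη.le.trans (hS.le_returnTime hglob hx),
    returnTime_le_two_mul hglob x⟩, subset_closure (hS.returnTime_mem hη hcl hglob hx),
    fun hint => hdisc ?_⟩
  exact hS.continuousWithinAt_returnTime hη hcl hglob hx hint

end FlowPaper
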